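/- Let G be a finite simple graph all of whose internal vertices are of type 0 or type 1, and let n_0 be the maximum number of vertices in a connected component of G_0 (with n_0 = 0 if G_0 has no vertices). Then G is well-covered if and only if G_0 is well-covered and for every independent set I of G contained in V(G_1) with |I| ≤ n_0 it holds that i(G_0 − N(I)) = α(G_0), where N(I) is the neighborhood of I in G and G_0 − N(I) is the subgraph of G induced on V(G_0) ∖ N(I). -/

import Mathlib

/-- `s` is an independent set in `G`: no two vertices of `s` are adjacent. -/
def IndepSet {V : Type*} (G : SimpleGraph V) (s : Set V) : Prop :=
  ∀ ⦃a⦄, a ∈ s → ∀ ⦃b⦄, b ∈ s → ¬ G.Adj a b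

/-- `s` is a maximal independent set in `G`. -/
def MaxIndepSet {V : Type*} (G : SimpleGraph V) (s : Set V) : Prop :=
  IndepSet G s ∧ ∀ t : Set V, IndepSet G t → s ⊆ t → s = t

/-- `α(G)`: the maximum size of an independent set of `G`. -/
noncomputable def alphaNum {V : Type*} (G : SimpleGraph V) : ℕ :=
  sSup {n | ∃ s : Set V, IndepSet G s ∧ s.ncard = n}

/-- `i(G)`: the minimum size of a maximal independent set of `G`. -/
noncomputable def iNum {V : Type*} (G : SimpleGraph V) : ℕ :=
  sInf {n | ∃ s : Set V, MaxIndepSet G s ∧ s.ncard = n}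

/-- The independence gap `μ_α(G) = α(G) - i(G)`. -/
noncomputable def indepGap {V : Type*} (G : SimpleGraph V) : ℕ :=
  alphaNum G - iNum G

/-- `G` is well-covered: all maximal independent sets have the same size. -/
def WellCovered {V : Type*} (G : SimpleGraph V) : Prop :=
  alphaNum G = iNum G

/-- `G` is almost well-covered: its independence gap equals 1. -/
def AlmostWellCovered {V : Type*} (G : SimpleGraph V) : Prop :=
  indepGap G = 1

/-- The (open) neighborhood `N(I)` of a set of vertices `I`. -/
def nbhd {V : Type*} (G : SimpleGraph V) (I : Set V) : Set V :=
  {v | ∃ u ∈ I, G.Adj u v}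

/-- `U(G)`: the set of vertices whose connected component induces a complete graph. -/
def completeU {V : Type*} (G : SimpleGraph V) : Set V :=
  {u | G.IsClique (G.connectedComponentMk u).supp}

/-- A leaf: a vertex of the graph `G - U(G)` having degree 1 there. -/
def IsLeaf {V : Type*} (G : SimpleGraph V) (v : V) : Prop :=
  v ∉ completeU G ∧ {u | u ∉ completeU G ∧ G.Adj v u}.ncard = 1

/-- An internal vertex: a vertex of `G - U(G)` that is not a leaf. -/
def IsInternal {V : Type*} (G : SimpleGraph V) (v : V) : Prop :=
  v ∉ completeU G ∧ ¬ IsLeaf G v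

/-- A vertex has type `k` if it is an internal vertex adjacent to exactly `k` leaves;
in addition every vertex of `U(G)` has type `0`. -/
def HasType {V : Type*} (G : SimpleGraph V) (v : V) (k : ℕ) : Prop :=
  (IsInternal G v ∧ {u | IsLeaf G u ∧ G.Adj v u}.ncard = k) ∨ (v ∈ completeU G ∧ k = 0)

/-- The set of vertices of type `k`; `G_k` is the subgraph induced by this set. -/
def typeSet {V : Type*} (G : SimpleGraph V) (k : ℕ) : Set V :=
  {v | HasType G v k}

/-- The maximum number of vertices in a connected component of `G`. -/
noncomputable def maxCompCard {V : Type*} (G : SimpleGraph V) : ℕ :=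
  sSup {n | ∃ c : G.ConnectedComponent, c.supp.ncard = n}

/-- `G` has no cycle of length `n`. -/
def NoCycleOfLength {V : Type*} (G : SimpleGraph V) (n : ℕ) : Prop :=
  ∀ (v : V) (w : G.Walk v v), w.IsCycle → w.length ≠ n

/-- `G` has girth at least 6: no cycle of length 3, 4, or 5. -/
def GirthAtLeastSix {V : Type*} (G : SimpleGraph V) : Prop :=
  NoCycleOfLength G 3 ∧ NoCycleOfLength G 4 ∧ NoCycleOfLength G 5

/-- A pendant edge: an edge incident with a vertex of degree 1. -/
def pendantEdges {V : Type*} (G : SimpleGraph V) : Set (Sym2 V) :=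
  {e | e ∈ G.edgeSet ∧ ∃ v ∈ e, (G.neighborSet v).ncard = 1}

/-- The pendant edges of `G` are pairwise disjoint and cover every vertex of `G`. -/
def PendantPerfectMatching {V : Type*} (G : SimpleGraph V) : Prop :=
  (∀ e ∈ pendantEdges G, ∀ f ∈ pendantEdges G, e ≠ f → ∀ v : V, v ∈ e → v ∉ f) ∧
  (∀ v : V, ∃ e ∈ pendantEdges G, v ∈ e)

/-- `s` is a maximal independent set of the subgraph of `G` induced by `A`, as a set of vertices
of `G`. -/
def MaxIndepIn {V : Type*} (G : SimpleGraph V) (A s : Set V) : Prop :=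
  s ⊆ A ∧ IndepSet G s ∧ ∀ v ∈ A, v ∉ s → ∃ u ∈ s, G.Adj u v

theorem IndepSet.mono {V : Type*} {G : SimpleGraph V} {s t : Set V} (ht : IndepSet G t)
    (hst : s ⊆ t) : IndepSet G s :=
  fun _ ha _ hb => ht (hst ha) (hst hb)

theorem IndepSet.union {V : Type*} {G : SimpleGraph V} {s t : Set V} (hs : IndepSet G s)
    (ht : IndepSet G t) (hst : ∀ a ∈ s, ∀ b ∈ t, ¬ G.Adj a b) : IndepSet G (s ∪ t) := by
  rintro a (ha | ha) b (hb | hb)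
  · exact hs ha hb
  · exact hst a ha b hb
  · exact fun h => hst b hb a ha h.symm
  · exact ht ha hb

theorem maxIndepSet_iff_maxIndepIn_univ {V : Type*} {G : SimpleGraph V} {s : Set V} :
    MaxIndepSet G s ↔ MaxIndepIn G Set.univ s := by
  constructor
  · rintro ⟨hs, hmax⟩
    refine ⟨Set.subset_univ _, hs, fun v _ hv => ?_⟩
    by_contra! hcon
    have hins : IndepSet G (s ∪ {v}) := by
      refine hs.union ?_ ?_
      · rintro a rfl b rfl
        exact G.irrefl
      · rintro a ha b rfl
        exact hcon a ha
    have heq := hmax _ hins Set.subset_union_left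
    exact hv (heq ▸ Or.inr rfl)
  · rintro ⟨-, hs, hdom⟩
    refine ⟨hs, fun t ht hst => hst.antisymm fun v hv => ?_⟩
    by_contra hvs
    obtain ⟨u, hu, huv⟩ := hdom v trivial hvs
    exact ht (hst hu) hv huv

theorem exists_maxIndepIn_superset {V : Type*} [Finite V] {G : SimpleGraph V} {A t : Set V}
    (htA : t ⊆ A) (ht : IndepSet G t) : ∃ s, t ⊆ s ∧ MaxIndepIn G A s := by
  obtain ⟨s, hts, hs⟩ := (Set.toFinite {s | s ⊆ A ∧ IndepSet G s}).exists_le_maximal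
    (show t ∈ {s | s ⊆ A ∧ IndepSet G s} from ⟨htA, ht⟩)
  refine ⟨s, hts, hs.prop.1, hs.prop.2, fun v hvA hv => ?_⟩
  by_contra! hcon
  have hins : IndepSet G (s ∪ {v}) := by
    refine hs.prop.2.union ?_ ?_
    · rintro a rfl b rfl
      exact G.irrefl
    · rintro a ha b rfl
      exact hcon a ha
  have hle := hs.le_of_ge (y := s ∪ {v})
    ⟨Set.union_subset hs.prop.1 (Set.singleton_subset_iff.2 hvA), hins⟩ Set.subset_union_left
  exact hv (hle (Or.inr rfl))

section Embedding

variable {V W : Type*} {G : SimpleGraph V} {H : SimpleGraph W} (φ : H ↪g G)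

theorem indepSet_image_iff (s : Set W) : IndepSet G (φ '' s) ↔ IndepSet H s := by
  constructor
  · intro h a ha b hb hab
    exact h ⟨a, ha, rfl⟩ ⟨b, hb, rfl⟩ (φ.map_adj_iff.2 hab)
  · rintro h _ ⟨a, ha, rfl⟩ _ ⟨b, hb, rfl⟩ hab
    exact h ha hb (φ.map_adj_iff.1 hab)

theorem maxIndepIn_range_image_iff (s : Set W) :
    MaxIndepIn G (Set.range φ) (φ '' s) ↔ MaxIndepSet H s := by
  rw [maxIndepSet_iff_maxIndepIn_univ]
  unfold MaxIndepIn
  rw [indepSet_image_iff]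
  simp only [Set.image_subset_range, Set.forall_mem_range, φ.injective.mem_set_image,
    Set.exists_mem_image, φ.map_adj_iff, Set.subset_univ, Set.mem_univ, true_and, true_imp_iff]

theorem MaxIndepIn.exists_eq_image {s : Set V} (hs : MaxIndepIn G (Set.range φ) s) :
    ∃ t, MaxIndepSet H t ∧ t.ncard = s.ncard := by
  obtain ⟨t, rfl⟩ := Set.subset_range_iff_exists_image_eq.1 hs.1
  exact ⟨t, (maxIndepIn_range_image_iff φ t).1 hs,
    (Set.ncard_image_of_injective _ φ.injective).symm⟩

theorem iNum_le {s : Set V} (hs : MaxIndepIn G (Set.range φ) s) :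
    iNum H ≤ s.ncard :=
  Nat.sInf_le (hs.exists_eq_image φ)

theorem exists_ncard_eq_iNum [Finite V] :
    ∃ s, MaxIndepIn G (Set.range φ) s ∧ s.ncard = iNum H := by
  obtain ⟨s, -, hs⟩ := exists_maxIndepIn_superset (G := G) (A := Set.range φ)
    (Set.empty_subset _) (fun a ha => ha.elim)
  obtain ⟨t, ht, htc⟩ := Nat.sInf_mem (s := {n | ∃ s : Set W, MaxIndepSet H s ∧ s.ncard = n})
    ⟨_, hs.exists_eq_image φ⟩
  exact ⟨φ '' t, (maxIndepIn_range_image_iff φ t).2 ht,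
    (Set.ncard_image_of_injective _ φ.injective).trans htc⟩

theorem bddAbove_ncard_indepSet [Finite W] :
    BddAbove {n | ∃ s : Set W, IndepSet H s ∧ s.ncard = n} :=
  ⟨Nat.card W, by rintro _ ⟨s, -, rfl⟩; exact Set.ncard_le_card s⟩

theorem ncard_le_alphaNum [Finite V] {s : Set V} (hsA : s ⊆ Set.range φ) (hs : IndepSet G s) :
    s.ncard ≤ alphaNum H := by
  have : Finite W := Finite.of_injective φ φ.injective
  obtain ⟨t, rfl⟩ := Set.subset_range_iff_exists_image_eq.1 hsA
  exact le_csSup bddAbove_ncard_indepSet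
    ⟨t, (indepSet_image_iff φ t).1 hs,
    (Set.ncard_image_of_injective _ φ.injective).symm⟩

theorem exists_ncard_eq_alphaNum [Finite V] :
    ∃ s, MaxIndepIn G (Set.range φ) s ∧ s.ncard = alphaNum H := by
  have : Finite W := Finite.of_injective φ φ.injective
  obtain ⟨t, ht, htc⟩ := Nat.sSup_mem (s := {n | ∃ s : Set W, IndepSet H s ∧ s.ncard = n})
    ⟨_, ∅, fun a ha => ha.elim, rfl⟩ bddAbove_ncard_indepSet
  obtain ⟨s, hts, hs⟩ := exists_maxIndepIn_superset (Set.image_subset_range φ t)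
    ((indepSet_image_iff φ t).2 ht)
  refine ⟨s, hs, (ncard_le_alphaNum φ hs.1 hs.2.1).antisymm ?_⟩
  calc alphaNum H = (φ '' t).ncard := (htc.symm : sSup _ = _).trans
        (Set.ncard_image_of_injective _ φ.injective).symm
    _ ≤ s.ncard := Set.ncard_le_ncard hts

end Embedding

section Induce

variable {V : Type*} {G : SimpleGraph V} {A : Set V}

theorem iNum_induce_le {s : Set V} (hs : MaxIndepIn G A s) : iNum (G.induce A) ≤ s.ncard :=
  iNum_le (SimpleGraph.Embedding.induce A) (by
    change MaxIndepIn G (Set.range Subtype.val) s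
    rwa [Subtype.range_coe])

variable [Finite V]

theorem exists_ncard_eq_iNum_induce (G : SimpleGraph V) (A : Set V) :
    ∃ s, MaxIndepIn G A s ∧ s.ncard = iNum (G.induce A) := by
  have h := exists_ncard_eq_iNum (SimpleGraph.Embedding.induce (G := G) A)
  change ∃ s, MaxIndepIn G (Set.range Subtype.val) s ∧ _ at h
  rwa [Subtype.range_coe] at h

theorem ncard_le_alphaNum_induce {s : Set V} (hsA : s ⊆ A) (hs : IndepSet G s) :
    s.ncard ≤ alphaNum (G.induce A) :=
  ncard_le_alphaNum (SimpleGraph.Embedding.induce A) (by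
    change s ⊆ Set.range Subtype.val
    rwa [Subtype.range_coe]) hs

theorem exists_ncard_eq_alphaNum_induce (G : SimpleGraph V) (A : Set V) :
    ∃ s, MaxIndepIn G A s ∧ s.ncard = alphaNum (G.induce A) := by
  have h := exists_ncard_eq_alphaNum (SimpleGraph.Embedding.induce (G := G) A)
  change ∃ s, MaxIndepIn G (Set.range Subtype.val) s ∧ _ at h
  rwa [Subtype.range_coe] at h

theorem wellCovered_iff_forall_ncard_eq :
    WellCovered G ↔
      ∀ s t, MaxIndepIn G Set.univ s → MaxIndepIn G Set.univ t → s.ncard = t.ncard := by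
  have hrange : Set.range (SimpleGraph.Embedding.refl (G := G)) = Set.univ :=
    Set.range_eq_univ.2 fun v => ⟨v, rfl⟩
  have hα := exists_ncard_eq_alphaNum (SimpleGraph.Embedding.refl (G := G))
  have hι := exists_ncard_eq_iNum (SimpleGraph.Embedding.refl (G := G))
  rw [hrange] at hα hι
  constructor
  · intro h
    have key : ∀ s, MaxIndepIn G Set.univ s → s.ncard = iNum G := fun s hs => by
      refine le_antisymm ?_ (iNum_le SimpleGraph.Embedding.refl (hrange.symm ▸ hs))
      rw [← show alphaNum G = iNum G from h]
      exact ncard_le_alphaNum SimpleGraph.Embedding.refl (hrange.symm ▸ hs.1) hs.2.1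
    exact fun s t hs ht => (key s hs).trans (key t ht).symm
  · intro h
    obtain ⟨s, hs, hsc⟩ := hα
    obtain ⟨t, ht, htc⟩ := hι
    exact hsc.symm.trans ((h s t hs ht).trans htc)

end Induce

section Types

variable {V : Type*} {G : SimpleGraph V}

theorem mem_completeU_iff_of_adj {u v : V} (h : G.Adj u v) :
    u ∈ completeU G ↔ v ∈ completeU G := by
  unfold completeU
  rw [Set.mem_ofPred_eq, Set.mem_ofPred_eq,
    SimpleGraph.ConnectedComponent.connectedComponentMk_eq_of_adj h]

theorem IsLeaf.exists_adj_iff {l : V} (hl : IsLeaf G l) : ∃ v, ∀ u, G.Adj l u ↔ u = v := by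
  obtain ⟨v, hv⟩ := Set.ncard_eq_one.1 hl.2
  refine ⟨v, fun u => ⟨fun h => ?_, ?_⟩⟩
  · have : u ∈ {u | u ∉ completeU G ∧ G.Adj l u} :=
      ⟨fun hu => hl.1 ((mem_completeU_iff_of_adj h).2 hu), h⟩
    rwa [hv] at this
  · rintro rfl
    exact (hv.symm ▸ rfl : u ∈ {u | u ∉ completeU G ∧ G.Adj l u}).2

theorem IsLeaf.not_isLeaf_of_adj {l v : V} (hl : IsLeaf G l) (h : G.Adj l v) :
    ¬ IsLeaf G v := by
  intro hv
  obtain ⟨a, ha⟩ := hl.exists_adj_iff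
  obtain ⟨b, hb⟩ := hv.exists_adj_iff
  obtain rfl := (ha v).1 h
  obtain rfl := (hb l).1 h.symm
  have hpair : ∀ x y : V, G.Reachable x y → (x = l ∨ x = v) → (y = l ∨ y = v) := by
    rintro x y ⟨w⟩
    induction w with
    | nil => exact id
    | cons hadj _ ih =>
      rintro (rfl | rfl)
      · exact ih (Or.inr ((ha _).1 hadj))
      · exact ih (Or.inl ((hb _).1 hadj))
  refine hl.1 fun x hx y hy hxy => ?_
  have hx' := hpair l x (SimpleGraph.ConnectedComponent.exact hx).symm (Or.inl rfl)
  have hy' := hpair l y (SimpleGraph.ConnectedComponent.exact hy).symm (Or.inl rfl)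
  rcases hx' with rfl | rfl <;> rcases hy' with rfl | rfl
  · exact absurd rfl hxy
  · exact h
  · exact h.symm
  · exact absurd rfl hxy

theorem not_isLeaf_of_hasType {v : V} {k : ℕ} (hv : HasType G v k) : ¬ IsLeaf G v := by
  rcases hv with h | h
  · exact h.1.2
  · exact fun hl => hl.1 h.1

theorem not_hasType_one_of_hasType_zero {v : V} (h0 : HasType G v 0) : ¬ HasType G v 1 := by
  rintro (h1 | h1)
  · rcases h0 with h0 | h0
    · exact zero_ne_one (h0.2.symm.trans h1.2)
    · exact h1.1.1 h0.1
  · exact one_ne_zero h1.2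

theorem HasType.exists_leaf {v : V} (h : HasType G v 1) :
    ∃ l, ∀ u, (IsLeaf G u ∧ G.Adj v u) ↔ u = l := by
  rcases h with h | h
  · obtain ⟨l, hl⟩ := Set.ncard_eq_one.1 h.2
    exact ⟨l, fun u => Set.ext_iff.1 hl u⟩
  · exact absurd h.2 one_ne_zero

theorem hasType_or_isLeaf
    (htypes : ∀ v : V, IsInternal G v → HasType G v 0 ∨ HasType G v 1) (v : V) :
    HasType G v 0 ∨ HasType G v 1 ∨ IsLeaf G v := by
  by_cases hU : v ∈ completeU G
  · exact Or.inl (Or.inr ⟨hU, rfl⟩)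
  · by_cases hl : IsLeaf G v
    · exact Or.inr (Or.inr hl)
    · exact (htypes v ⟨hU, hl⟩).imp_right Or.inl

theorem IsLeaf.exists_support [Finite V]
    (htypes : ∀ v : V, IsInternal G v → HasType G v 0 ∨ HasType G v 1) {l : V}
    (hl : IsLeaf G l) : ∃ v, HasType G v 1 ∧ ∀ u, G.Adj l u ↔ u = v := by
  obtain ⟨v, hv⟩ := hl.exists_adj_iff
  have hlv : G.Adj l v := (hv v).2 rfl
  have hvU : v ∉ completeU G := fun h => hl.1 ((mem_completeU_iff_of_adj hlv).2 h)
  refine ⟨v, ?_, hv⟩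
  rcases htypes v ⟨hvU, hl.not_isLeaf_of_adj hlv⟩ with (h | h) | h
  · have hempty := (Set.ncard_eq_zero (Set.toFinite _)).1 h.2
    exact absurd ⟨hl, hlv.symm⟩ (Set.eq_empty_iff_forall_notMem.1 hempty l)
  · exact absurd h.1 hvU
  · exact h

/-- Every maximal independent set contains exactly one vertex of each pair consisting of a vertex
of type `1` and its leaf. -/
theorem MaxIndepIn.ncard_eq_add [Finite V]
    (htypes : ∀ v : V, IsInternal G v → HasType G v 0 ∨ HasType G v 1) {S : Set V}
    (hS : MaxIndepIn G Set.univ S) :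
    S.ncard = (S ∩ typeSet G 0).ncard + (typeSet G 1).ncard := by
  classical
  have hsupp : ∀ l, ∃ v, IsLeaf G l → HasType G v 1 ∧ ∀ u, G.Adj l u ↔ u = v := fun l => by
    by_cases hl : IsLeaf G l
    · obtain ⟨v, hv⟩ := hl.exists_support htypes
      exact ⟨v, fun _ => hv⟩
    · exact ⟨l, fun h => absurd h hl⟩
  choose g hg using hsupp
  have hbij : Set.BijOn (fun v => if IsLeaf G v then g v else v) (S \ typeSet G 0)
      (typeSet G 1) := by
    refine ⟨?_, ?_, ?_⟩
    · rintro v ⟨-, hv0⟩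
      by_cases hl : IsLeaf G v
      · simpa [hl, typeSet] using (hg v hl).1
      · simpa [hl, typeSet] using
          ((hasType_or_isLeaf htypes v).resolve_left hv0).resolve_right hl
    · rintro x ⟨hxS, -⟩ y ⟨hyS, -⟩ hxy
      by_cases hx : IsLeaf G x <;> by_cases hy : IsLeaf G y <;> simp only [hx, hy, if_true,
        if_false] at hxy
      · obtain ⟨l, hl⟩ := (hg x hx).1.exists_leaf
        have hxl := (hl x).1 ⟨hx, (((hg x hx).2 _).2 rfl).symm⟩
        have hyl := (hl y).1 ⟨hy, (((hg y hy).2 _).2 hxy).symm⟩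
        exact hxl.trans hyl.symm
      · exact absurd (((hg x hx).2 y).2 hxy.symm) (hS.2.1 hxS hyS)
      · exact absurd (((hg y hy).2 x).2 hxy) (hS.2.1 hyS hxS)
      · exact hxy
    · intro v hv
      by_cases hvS : v ∈ S
      · exact ⟨v, ⟨hvS, fun h0 => not_hasType_one_of_hasType_zero h0 hv⟩,
          if_neg (not_isLeaf_of_hasType hv)⟩
      · obtain ⟨l, hl⟩ := HasType.exists_leaf hv
        obtain ⟨hleaf, hadj⟩ := (hl l).2 rfl
        have hgl : v = g l := ((hg l hleaf).2 v).1 hadj.symm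
        refine ⟨l, ⟨?_, fun h0 => not_isLeaf_of_hasType h0 hleaf⟩, by simp [hleaf, hgl]⟩
        by_contra hlS
        obtain ⟨u, huS, hul⟩ := hS.2.2 l trivial hlS
        exact hvS (hgl ▸ ((hg l hleaf).2 u).1 hul.symm ▸ huS)
  rw [← hbij.image_eq, hbij.injOn.ncard_image,
    Set.ncard_inter_add_ncard_sdiff_eq_ncard]

theorem MaxIndepIn.inter_typeSet_zero [Finite V]
    (htypes : ∀ v : V, IsInternal G v → HasType G v 0 ∨ HasType G v 1) {S : Set V}
    (hS : MaxIndepIn G Set.univ S) :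
    MaxIndepIn G (typeSet G 0 \ nbhd G (S ∩ typeSet G 1)) (S ∩ typeSet G 0) := by
  refine ⟨fun v hv => ⟨hv.2, ?_⟩, hS.2.1.mono Set.inter_subset_left, fun v hv hvS => ?_⟩
  · rintro ⟨u, hu, huv⟩
    exact hS.2.1 hu.1 hv.1 huv
  · obtain ⟨u, huS, huv⟩ := hS.2.2 v trivial fun h => hvS ⟨h, hv.1⟩
    rcases hasType_or_isLeaf htypes u with h | h | h
    · exact ⟨u, ⟨huS, h⟩, huv⟩
    · exact absurd ⟨u, ⟨huS, h⟩, huv⟩ hv.2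
    · obtain ⟨w, hw, hadj⟩ := h.exists_support htypes
      obtain rfl := (hadj v).1 huv
      exact absurd hw (not_hasType_one_of_hasType_zero hv.1)

theorem exists_maxIndepIn_inter_typeSet_zero_eq [Finite V]
    (htypes : ∀ v : V, IsInternal G v → HasType G v 0 ∨ HasType G v 1) {I T : Set V}
    (hI : IndepSet G I) (hI1 : I ⊆ typeSet G 1)
    (hT : MaxIndepIn G (typeSet G 0 \ nbhd G I) T) :
    ∃ S, MaxIndepIn G Set.univ S ∧ S ∩ typeSet G 0 = T := by
  have hTI : IndepSet G (I ∪ T) :=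
    hI.union hT.2.1 fun a ha b hb hab => (hT.1 hb).2 ⟨a, ha, hab⟩
  refine ⟨(I ∪ T) ∪ {l | IsLeaf G l ∧ ∀ v ∈ I, ¬ G.Adj l v},
    ⟨Set.subset_univ _, hTI.union ?_ ?_, ?_⟩, ?_⟩
  · exact fun a ha b hb hab => ha.1.not_isLeaf_of_adj hab hb.1
  · rintro a (ha | ha) l ⟨hl, hlI⟩ hal
    · exact hlI a ha hal.symm
    · obtain ⟨w, hw, hadj⟩ := hl.exists_support htypes
      obtain rfl := (hadj a).1 hal.symm
      exact not_hasType_one_of_hasType_zero (hT.1 ha).1 hw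
  · intro v _ hv
    rcases hasType_or_isLeaf htypes v with h | h | h
    · by_cases hvN : v ∈ nbhd G I
      · obtain ⟨u, hu, huv⟩ := hvN
        exact ⟨u, Or.inl (Or.inl hu), huv⟩
      · obtain ⟨u, hu, huv⟩ := hT.2.2 v ⟨h, hvN⟩ fun hvT => hv (Or.inl (Or.inr hvT))
        exact ⟨u, Or.inl (Or.inr hu), huv⟩
    · obtain ⟨l, hl⟩ := HasType.exists_leaf h
      obtain ⟨hleaf, hvl⟩ := (hl l).2 rfl
      refine ⟨l, Or.inr ⟨hleaf, fun u hu hlu => ?_⟩, hvl.symm⟩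
      obtain ⟨w, hadj⟩ := hleaf.exists_adj_iff
      have huv : u = v := ((hadj u).1 hlu).trans ((hadj v).1 hvl.symm).symm
      exact hv (Or.inl (Or.inl (huv ▸ hu)))
    · have hex : ∃ u ∈ I, G.Adj v u := by
        by_contra! hcon
        exact hv (Or.inr ⟨h, hcon⟩)
      obtain ⟨u, hu, hvu⟩ := hex
      exact ⟨u, Or.inl (Or.inl hu), hvu.symm⟩
  · ext v
    constructor
    · rintro ⟨(hv | hv) | hv, h0⟩
      · exact absurd (hI1 hv) (not_hasType_one_of_hasType_zero h0)
      · exact hv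
      · exact absurd hv.1 (not_isLeaf_of_hasType h0)
    · exact fun hv => ⟨Or.inl (Or.inr hv), (hT.1 hv).1⟩

theorem wellCovered_iff_forall_typeSet_one [Finite V]
    (htypes : ∀ v : V, IsInternal G v → HasType G v 0 ∨ HasType G v 1) :
    WellCovered G ↔ ∀ I T, IndepSet G I → I ⊆ typeSet G 1 →
      MaxIndepIn G (typeSet G 0 \ nbhd G I) T →
        T.ncard = alphaNum (G.induce (typeSet G 0)) := by
  rw [wellCovered_iff_forall_ncard_eq]
  constructor
  · intro h I T hI hI1 hT
    obtain ⟨M, hM, hMc⟩ := exists_ncard_eq_alphaNum_induce G (typeSet G 0)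
    have hM' : MaxIndepIn G (typeSet G 0 \ nbhd G ∅) M := by
      simpa [nbhd] using hM
    obtain ⟨S, hS, hST⟩ := exists_maxIndepIn_inter_typeSet_zero_eq htypes hI hI1 hT
    obtain ⟨S', hS', hSM⟩ := exists_maxIndepIn_inter_typeSet_zero_eq htypes
      (fun a ha => ha.elim) (Set.empty_subset _) hM'
    have heq := h S S' hS hS'
    rw [hS.ncard_eq_add htypes, hS'.ncard_eq_add htypes, hST, hSM] at heq
    rw [← hMc]
    exact Nat.add_right_cancel heq
  · intro h S S' hS hS'
    rw [hS.ncard_eq_add htypes, hS'.ncard_eq_add htypes,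
      h _ _ (hS.2.1.mono Set.inter_subset_left) Set.inter_subset_right
        (hS.inter_typeSet_zero htypes),
      h _ _ (hS'.2.1.mono Set.inter_subset_left) Set.inter_subset_right
        (hS'.inter_typeSet_zero htypes)]

end Types

section Components

variable {V : Type*} {G : SimpleGraph V} {A : Set V}

theorem mem_image_supp_of_adj {c : (G.induce A).ConnectedComponent} {u v : V}
    (hu : u ∈ Subtype.val '' c.supp) (hv : v ∈ A) (huv : G.Adj u v) :
    v ∈ Subtype.val '' c.supp := by
  obtain ⟨x, hx, rfl⟩ := hu
  refine ⟨⟨v, hv⟩, ?_, rfl⟩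
  have hadj : (G.induce A).Adj x ⟨v, hv⟩ := huv
  exact (SimpleGraph.ConnectedComponent.connectedComponentMk_eq_of_adj hadj).symm.trans hx

theorem ncard_supp_le_maxCompCard {W : Type*} [Finite W] {H : SimpleGraph W}
    (c : H.ConnectedComponent) : c.supp.ncard ≤ maxCompCard H :=
  le_csSup ⟨Nat.card W, by rintro _ ⟨c, rfl⟩; exact Set.ncard_le_card _⟩ ⟨c, rfl⟩

theorem ncard_le_ncard_of_forall_supp [Finite V] {M T : Set V} (hM : M ⊆ A)
    (h : ∀ c : (G.induce A).ConnectedComponent,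
      (M ∩ Subtype.val '' c.supp).ncard ≤ (T ∩ Subtype.val '' c.supp).ncard) :
    M.ncard ≤ T.ncard := by
  classical
  have := Fintype.ofFinite V
  have := Fintype.ofFinite (G.induce A).ConnectedComponent
  have hdisj : Pairwise (Function.onFun Disjoint fun c : (G.induce A).ConnectedComponent =>
      T ∩ Subtype.val '' c.supp) := by
    intro c d hcd
    refine Set.disjoint_left.2 ?_
    rintro _ ⟨-, x, hx, rfl⟩ ⟨-, y, hy, hxy⟩
    obtain rfl := Subtype.val_injective hxy
    exact hcd (Eq.trans (Eq.symm hx) hy)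
  calc M.ncard
      ≤ (⋃ c : (G.induce A).ConnectedComponent, M ∩ Subtype.val '' c.supp).ncard := by
        refine Set.ncard_le_ncard (fun v hv => Set.mem_iUnion.2 ?_)
        exact ⟨(G.induce A).connectedComponentMk ⟨v, hM hv⟩, hv, ⟨v, hM hv⟩, rfl, rfl⟩
    _ ≤ ∑ c : (G.induce A).ConnectedComponent, (M ∩ Subtype.val '' c.supp).ncard :=
        Set.ncard_iUnion_le_of_fintype _
    _ ≤ ∑ c : (G.induce A).ConnectedComponent, (T ∩ Subtype.val '' c.supp).ncard :=
        Finset.sum_le_sum fun c _ => h c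
    _ = (⋃ c : (G.induce A).ConnectedComponent, T ∩ Subtype.val '' c.supp).ncard := by
        rw [Set.ncard_iUnion_of_finite (fun _ => Set.toFinite _) hdisj, finsum_eq_sum_of_fintype]
    _ ≤ T.ncard := Set.ncard_le_ncard (Set.iUnion_subset fun _ => Set.inter_subset_left)

theorem exists_subset_ncard_le_inter_nbhd [Finite V] (I C : Set V) :
    ∃ J ⊆ I, J.ncard ≤ C.ncard ∧ C ∩ nbhd G I ⊆ nbhd G J := by
  classical
  have hex : ∀ v, ∃ u, v ∈ nbhd G I → u ∈ I ∧ G.Adj u v := fun v => by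
    by_cases hv : v ∈ nbhd G I
    · obtain ⟨u, hu⟩ := hv
      exact ⟨u, fun _ => hu⟩
    · exact ⟨v, fun h => absurd h hv⟩
  choose f hf using hex
  refine ⟨f '' (C ∩ nbhd G I), ?_, ?_, ?_⟩
  · rintro _ ⟨v, hv, rfl⟩
    exact (hf v hv.2).1
  · exact (Set.ncard_image_le (Set.toFinite _)).trans (Set.ncard_le_ncard Set.inter_subset_left)
  · exact fun v hv => ⟨f v, ⟨v, hv, rfl⟩, (hf v hv.2).2⟩

theorem ncard_eq_alphaNum_of_forall_ncard_le [Finite V] {B : Set V}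
    (h : ∀ I, IndepSet G I → I ⊆ B → I.ncard ≤ maxCompCard (G.induce A) →
      alphaNum (G.induce A) ≤ iNum (G.induce (A \ nbhd G I)))
    {I T : Set V} (hI : IndepSet G I) (hIB : I ⊆ B) (hT : MaxIndepIn G (A \ nbhd G I) T) :
    T.ncard = alphaNum (G.induce A) := by
  have hTA : T ⊆ A := fun v hv => (hT.1 hv).1
  refine (ncard_le_alphaNum_induce hTA hT.2.1).antisymm ?_
  obtain ⟨M, hM, hMc⟩ := exists_ncard_eq_alphaNum_induce G A
  rw [← hMc]
  refine ncard_le_ncard_of_forall_supp (G := G) hM.1 fun c => ?_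
  set C : Set V := Subtype.val '' c.supp with hC
  have hCA : C ⊆ A := by
    rintro _ ⟨x, -, rfl⟩
    exact x.2
  obtain ⟨J, hJI, hJc, hJ⟩ := exists_subset_ncard_le_inter_nbhd (G := G) I C
  have hJI' : nbhd G J ⊆ nbhd G I := fun v ⟨u, hu, huv⟩ => ⟨u, hJI hu, huv⟩
  rw [hC, Set.ncard_image_of_injective _ Subtype.val_injective] at hJc
  have hle := h J (hI.mono hJI) (hJI.trans hIB) (hJc.trans (ncard_supp_le_maxCompCard c))
  obtain ⟨S, hTS, hS⟩ := exists_maxIndepIn_superset (G := G) (A := A \ nbhd G J) (t := T ∩ C)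
    (fun v hv => ⟨hTA hv.1, fun hvJ => (hT.1 hv.1).2 (hJI' hvJ)⟩)
    (hT.2.1.mono Set.inter_subset_left)
  have hSA : S ⊆ A := fun v hv => (hS.1 hv).1
  have hSC : S ∩ C ⊆ T ∩ C := by
    rintro v ⟨hvS, hvC⟩
    refine ⟨?_, hvC⟩
    by_contra hvT
    obtain ⟨u, huT, huv⟩ := hT.2.2 v
      ⟨hCA hvC, fun hvI => (hS.1 hvS).2 (hJ ⟨hvC, hvI⟩)⟩ hvT
    exact hS.2.1 (hTS ⟨huT, mem_image_supp_of_adj hvC (hTA huT) huv.symm⟩) hvS huv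
  have hind : IndepSet G ((M ∩ C) ∪ (S \ C)) :=
    (hM.2.1.mono Set.inter_subset_left).union (hS.2.1.mono Set.sdiff_subset)
      fun a ha b hb hab => hb.2 (mem_image_supp_of_adj ha.2 (hSA hb.1) hab)
  have hα := ncard_le_alphaNum_induce (A := A)
    (Set.union_subset (Set.inter_subset_left.trans hM.1) (Set.sdiff_subset.trans hSA)) hind
  rw [Set.ncard_union_eq (Set.disjoint_left.2 fun v hv hv' => hv'.2 hv.2)] at hα
  have hsplit := Set.ncard_inter_add_ncard_sdiff_eq_ncard S C
  have hTC := Set.ncard_le_ncard hSC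
  have hιS := iNum_induce_le hS
  omega

end Components

/-- For a graph all of whose internal vertices are of type 0 or 1,
`G` is well-covered iff `G₀` is well-covered and every independent set `I ⊆ V(G₁)` with
`|I| ≤ n₀` satisfies `i(G₀ − N(I)) = α(G₀)`. -/
theorem wellCovered_iff_types01 {V : Type*} [Fintype V] (G : SimpleGraph V)
    (htypes : ∀ v : V, IsInternal G v → HasType G v 0 ∨ HasType G v 1)
    (n0 : ℕ) (hn0 : n0 = maxCompCard (G.induce (typeSet G 0))) :
    WellCovered G ↔
      WellCovered (G.induce (typeSet G 0)) ∧
        ∀ I : Set V, IndepSet G I → I ⊆ typeSet G 1 → I.ncard ≤ n0 →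
          iNum (G.induce (typeSet G 0 \ nbhd G I)) =
            alphaNum (G.induce (typeSet G 0)) := by
  rw [wellCovered_iff_forall_typeSet_one htypes]
  constructor
  · intro h
    have key : ∀ I : Set V, IndepSet G I → I ⊆ typeSet G 1 →
        iNum (G.induce (typeSet G 0 \ nbhd G I)) = alphaNum (G.induce (typeSet G 0)) := by
      intro I hI hI1
      obtain ⟨T, hT, hTc⟩ := exists_ncard_eq_iNum_induce G (typeSet G 0 \ nbhd G I)
      exact hTc.symm.trans (h I T hI hI1 hT)
    refine ⟨?_, fun I hI hI1 _ => key I hI hI1⟩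
    have h0 := key ∅ (fun a ha => ha.elim) (Set.empty_subset _)
    rw [show nbhd G ∅ = ∅ by simp [nbhd], Set.sdiff_empty] at h0
    exact h0.symm
  · rintro ⟨-, h⟩ I T hI hI1 hT
    exact ncard_eq_alphaNum_of_forall_ncard_le
      (fun J hJ hJ1 hJc => (h J hJ hJ1 (hn0 ▸ hJc)).ge) hI hI1 hT
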